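/- Let (W, ω) be a symplectic vector space and P_t, P̃_t : W → W two smooth families of linear symplectic maps with P_0 = P̃_0 = Id, generated by quadratic Hamiltonians h_t, H_t (i.e., d/dt P_t = h⃗_t P_t, etc.). If h_t − H_t ≤ 0 (nonpositive definite) for all t ∈ [0,T] and Λ₀ is Lagrangian, then the number of times τ ∈ (0,T] with P_τΛ₀ ∩ Λ₀ ≠ 0 (counted with dim of intersection), for monotone nondecreasing curves of constant Young diagram, is at most the corresponding count for P̃_τΛ₀. -/

import Mathlib

open Module
set_option linter.unusedSectionVars false
set_option linter.unusedSimpArgs false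
set_option linter.unusedVariables false

namespace Sturm
open scoped Topology

section Inertia
variable {V V' : Type*} [AddCommGroup V] [Module ℝ V] [FiniteDimensional ℝ V]
  [AddCommGroup V'] [Module ℝ V'] [FiniteDimensional ℝ V']

theorem sigPos_le_of_inj (Q : QuadraticForm ℝ V) (Q' : QuadraticForm ℝ V') (g : V →ₗ[ℝ] V')
    (hg : Function.Injective g) (h : ∀ x, Q x ≤ Q' (g x)) : sigPos Q ≤ sigPos Q' := by
  obtain ⟨N, hN, hpos⟩ := exists_finrank_eq_sigPos_and_posDef Q
  rw [← hN, LinearEquiv.finrank_eq (Submodule.equivMapOfInjective g hg N)]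
  apply le_sigPos_of_posDef
  rintro ⟨y, x, hx, rfl⟩ hne
  have hx0 : x ≠ 0 := by
    rintro rfl
    exact hne (by ext; simp)
  have := hpos ⟨x, hx⟩ (by simpa using hx0)
  simp only [QuadraticMap.restrict_apply] at this ⊢
  exact lt_of_lt_of_le this (h x)

theorem sigNeg_le_of_inj (Q : QuadraticForm ℝ V) (Q' : QuadraticForm ℝ V') (g : V →ₗ[ℝ] V')
    (hg : Function.Injective g) (h : ∀ x, Q' (g x) ≤ Q x) : sigNeg Q ≤ sigNeg Q' := by
  rw [← sigPos_neg, ← sigPos_neg]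
  exact sigPos_le_of_inj _ _ g hg (by simpa using h)

theorem sigNeg_eq_of_equiv (Q : QuadraticForm ℝ V) (Q' : QuadraticForm ℝ V') (g : V ≃ₗ[ℝ] V')
    (h : ∀ x, Q' (g x) = Q x) : sigNeg Q = sigNeg Q' := by
  apply le_antisymm
  · exact sigNeg_le_of_inj _ _ g.toLinearMap g.injective (fun x => (h x).le)
  · refine sigNeg_le_of_inj _ _ g.symm.toLinearMap g.symm.injective (fun x => ?_)
    have := h (g.symm x)
    simp at this
    simp [this]

theorem sigPos_prod_ge (Q : QuadraticForm ℝ V) (Q' : QuadraticForm ℝ V') :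
    sigPos Q + sigPos Q' ≤ sigPos (QuadraticMap.prod Q Q') := by
  obtain ⟨N, hN, hpos⟩ := exists_finrank_eq_sigPos_and_posDef Q
  obtain ⟨N', hN', hpos'⟩ := exists_finrank_eq_sigPos_and_posDef Q'
  have hinj : Function.Injective (N.subtype.prodMap N'.subtype) :=
    Function.Injective.prodMap N.injective_subtype N'.injective_subtype
  rw [← hN, ← hN', ← Module.finrank_prod,
    ← LinearMap.finrank_range_of_inj hinj]
  apply le_sigPos_of_posDef
  rintro ⟨_, ⟨x, y⟩, rfl⟩ hne
  have h1 : 0 ≤ Q x := by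
    by_cases hx : x = 0
    · simp [hx]
    · exact (hpos x hx).le
  have h2 : 0 ≤ Q' y := by
    by_cases hx : y = 0
    · simp [hx]
    · exact (hpos' y hx).le
  have h3 : x ≠ 0 ∨ y ≠ 0 := by
    by_contra hcon
    push Not at hcon
    apply hne
    ext <;> simp [hcon.1, hcon.2]
  simp only [QuadraticMap.restrict_apply, LinearMap.prodMap_apply, QuadraticMap.prod_apply,
    Submodule.subtype_apply]
  rcases h3 with h | h
  · have := hpos x h
    simp only [QuadraticMap.restrict_apply] at this
    linarith
  · have := hpos' y h
    simp only [QuadraticMap.restrict_apply] at this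
    linarith

theorem sigNeg_prod (Q : QuadraticForm ℝ V) (Q' : QuadraticForm ℝ V') :
    sigNeg (QuadraticMap.prod Q Q') = sigNeg Q + sigNeg Q' := by
  have h1 := sigPos_prod_ge Q Q'
  have h2 := sigPos_prod_ge (-Q) (-Q')
  have h3 : QuadraticMap.prod (-Q) (-Q') = -(QuadraticMap.prod Q Q') := by
    ext x
    simp
    ring
  rw [h3] at h2
  simp only [sigPos_neg] at h2
  have e1 := QuadraticForm.sigPos_add_sigNeg_add_radical (Q := Q)
  have e2 := QuadraticForm.sigPos_add_sigNeg_add_radical (Q := Q')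
  have e3 := QuadraticForm.sigPos_add_sigNeg_add_radical (Q := QuadraticMap.prod Q Q')
  have h4 : finrank ℝ Q.radical + finrank ℝ Q'.radical
      ≤ finrank ℝ (QuadraticMap.prod Q Q').radical := by
    have hinj : Function.Injective (Q.radical.subtype.prodMap Q'.radical.subtype) :=
      Function.Injective.prodMap (Submodule.injective_subtype _) (Submodule.injective_subtype _)
    rw [← Module.finrank_prod, ← LinearMap.finrank_range_of_inj hinj]
    apply Submodule.finrank_mono
    rintro _ ⟨⟨⟨x, hx⟩, ⟨y, hy⟩⟩, rfl⟩
    rw [QuadraticMap.mem_radical_iff'] at hx hy ⊢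
    simp only [LinearMap.prodMap_apply, QuadraticMap.prod_apply, Submodule.subtype_apply]
    refine ⟨by rw [hx.1, hy.1, add_zero], ?_⟩
    rintro ⟨a, b⟩
    simp [hx.2, hy.2]
  rw [Module.finrank_prod] at e3
  omega

end Inertia

theorem sigPos_lsc {V : Type*} [NormedAddCommGroup V] [NormedSpace ℝ V] [FiniteDimensional ℝ V]
    (Q : ℝ → QuadraticForm ℝ V) (U : Set ℝ) (τ : ℝ) (hτ : τ ∈ U)
    (hc : ContinuousOn (fun p : ℝ × V => Q p.1 p.2) (U ×ˢ Set.univ)) :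
    ∀ᶠ t in 𝓝[U] τ, sigPos (Q τ) ≤ sigPos (Q t) := by
  obtain ⟨N, hN, hpos⟩ := exists_finrank_eq_sigPos_and_posDef (Q τ)
  have hK : IsCompact (Metric.sphere (0 : N) 1) := isCompact_sphere _ _
  have key : ∀ᶠ t in 𝓝[U] τ, ∀ x ∈ Metric.sphere (0 : N) 1, 0 < Q t (x : V) := by
    refine hK.induction_on (p := fun s => ∀ᶠ t in 𝓝[U] τ, ∀ x ∈ s, 0 < Q t (x : V))
      (by simp) (fun s t hst h => h.mono fun r hr x hx => hr x (hst hx))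
      (fun s t h1 h2 => (h1.and h2).mono fun r hr x hx => hx.elim (hr.1 x) (hr.2 x)) ?_
    intro x hx
    have hx0 : x ≠ 0 := by
      rintro rfl
      simp at hx
    have h0 : 0 < Q τ (x : V) := hpos x hx0
    have h1 := (hc (τ, (x : V)) ⟨hτ, trivial⟩).tendsto
    have h2 : Filter.Tendsto (fun z : N × ℝ => (z.2, (z.1 : V))) (𝓝 x ×ˢ 𝓝[U] τ)
        (𝓝[U ×ˢ Set.univ] (τ, (x : V))) := by
      rw [nhdsWithin_prod_eq, nhdsWithin_univ]
      exact Filter.Tendsto.prodMk Filter.tendsto_snd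
        ((continuous_subtype_val.tendsto x).comp Filter.tendsto_fst)
    have h3 := (h1.comp h2).eventually (lt_mem_nhds h0)
    obtain ⟨pa, hpa, pb, hpb, hab⟩ := Filter.eventually_prod_iff.mp h3
    refine ⟨{y | pa y}, mem_nhdsWithin_of_mem_nhds hpa, ?_⟩
    filter_upwards [hpb] with t ht y hy
    exact hab hy ht
  filter_upwards [key] with t ht
  rw [← hN]
  apply le_sigPos_of_posDef
  intro x hx
  have hn : ‖x‖ ≠ 0 := norm_ne_zero_iff.mpr hx
  have := ht (‖x‖⁻¹ • x) (by
    rw [mem_sphere_zero_iff_norm, norm_smul, norm_inv, norm_norm, inv_mul_cancel₀ hn])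
  rw [Submodule.coe_smul, QuadraticMap.map_smul] at this
  simp only [QuadraticMap.restrict_apply]
  have h2 : 0 < ‖x‖⁻¹ * ‖x‖⁻¹ := by positivity
  exact (pos_iff_pos_of_mul_pos this).mp h2

theorem sigNeg_lsc {V : Type*} [NormedAddCommGroup V] [NormedSpace ℝ V] [FiniteDimensional ℝ V]
    (Q : ℝ → QuadraticForm ℝ V) (U : Set ℝ) (τ : ℝ) (hτ : τ ∈ U)
    (hc : ContinuousOn (fun p : ℝ × V => Q p.1 p.2) (U ×ˢ Set.univ)) :
    ∀ᶠ t in 𝓝[U] τ, sigNeg (Q τ) ≤ sigNeg (Q t) :=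
  sigPos_lsc (fun t => - Q t) U τ hτ hc.neg

/-- A locally constant function on a preconnected set is constant. -/
theorem const_of_local {α : Type*} (n : ℝ → α) (U : Set ℝ) (hU : IsPreconnected U)
    (h : ∀ τ ∈ U, ∀ᶠ t in 𝓝[U] τ, n t = n τ) : ∀ s ∈ U, ∀ t ∈ U, n s = n t := by
  intro s hs t ht
  let _ : TopologicalSpace α := ⊥
  have : DiscreteTopology α := ⟨rfl⟩
  have hc : ContinuousOn n U := by
    intro τ hτ
    rw [ContinuousWithinAt, nhds_discrete, Filter.tendsto_pure]
    exact h τ hτ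
  exact hU.constant hc hs ht

/-- If the radical has constant dimension, then the negative index is constant. -/
theorem sigNeg_const {V : Type*} [NormedAddCommGroup V] [NormedSpace ℝ V] [FiniteDimensional ℝ V]
    (Q : ℝ → QuadraticForm ℝ V) (U : Set ℝ) (hU : IsPreconnected U)
    (hc : ContinuousOn (fun p : ℝ × V => Q p.1 p.2) (U ×ˢ Set.univ)) (k : ℕ)
    (hk : ∀ t ∈ U, finrank ℝ (Q t).radical = k) :
    ∀ s ∈ U, ∀ t ∈ U, sigNeg (Q s) = sigNeg (Q t) := by
  apply const_of_local (fun t => sigNeg (Q t)) U hU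
  intro τ hτ
  filter_upwards [sigNeg_lsc Q U τ hτ hc, sigPos_lsc Q U τ hτ hc, self_mem_nhdsWithin]
    with t h1 h2 h3
  have e1 := QuadraticForm.sigPos_add_sigNeg_add_radical (Q := Q t)
  have e2 := QuadraticForm.sigPos_add_sigNeg_add_radical (Q := Q τ)
  rw [hk t h3] at e1
  rw [hk τ hτ] at e2
  omega

/-- Combinatorial counting lemma. `n` is the negative index, `p` the positive index, `k` the
nullity. -/
theorem count_lemma (n p k : ℝ → ℕ) (U : Set ℝ) (hU : IsPreconnected U) (d : ℕ)
    (hsum : ∀ t ∈ U, p t + n t + k t = d)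
    (hn : ∀ s ∈ U, ∀ t ∈ U, s ≤ t → n t ≤ n s) (hp : ∀ s ∈ U, ∀ t ∈ U, s ≤ t → p s ≤ p t)
    (hnl : ∀ τ ∈ U, ∀ᶠ t in 𝓝[U] τ, n τ ≤ n t) (hpl : ∀ τ ∈ U, ∀ᶠ t in 𝓝[U] τ, p τ ≤ p t)
    (F : Finset ℝ) (hF : ∀ t ∈ U, (∃ s ∈ U, s < t) → (t ∈ F ↔ k t ≠ 0)) :
    ∀ s ∈ U, ∀ t ∈ U, n s + ∑ σ ∈ F with σ ≤ s, k σ = n t + ∑ σ ∈ F with σ ≤ t, k σ := by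
  apply const_of_local (fun t => n t + ∑ σ ∈ F with σ ≤ t, k σ) U hU
  intro τ hτ
  have hfar : ∀ᶠ t in 𝓝[U] τ, ∀ σ ∈ F, σ ≠ τ → (σ ≤ t ↔ σ ≤ τ) ∧ σ ≠ t := by
    apply Filter.Eventually.filter_mono nhdsWithin_le_nhds
    rw [Filter.eventually_all_finset]
    intro σ hσ
    rcases lt_trichotomy σ τ with h | h | h
    · filter_upwards [lt_mem_nhds h] with t ht _
      exact ⟨⟨fun _ => h.le, fun _ => ht.le⟩, ht.ne⟩
    · simp [h]
    · filter_upwards [gt_mem_nhds h] with t ht _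
      exact ⟨⟨fun h' => absurd h' (not_le.mpr ht), fun h' => absurd h' (not_le.mpr h)⟩, ht.ne'⟩
  have hmin : ∀ᶠ t in 𝓝[U] τ, t < τ → ∃ s ∈ U, s < t := by
    by_cases hex : ∃ s ∈ U, s < τ
    · obtain ⟨s, hs, hsτ⟩ := hex
      apply Filter.Eventually.filter_mono nhdsWithin_le_nhds
      filter_upwards [lt_mem_nhds hsτ] with t ht _
      exact ⟨s, hs, ht⟩
    · filter_upwards [self_mem_nhdsWithin] with t ht h
      exact absurd ⟨t, ht, h⟩ hex
  filter_upwards [hnl τ hτ, hpl τ hτ, self_mem_nhdsWithin, hfar, hmin] with t h1 h2 ht h3 h5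
  rcases lt_trichotomy t τ with h | h | h
  · have h4 := hp t ht τ hτ h.le
    have e1 := hsum t ht
    have e2 := hsum τ hτ
    have hFτ := hF τ hτ ⟨t, ht, h⟩
    have hkt : k t = 0 := by
      by_contra hne
      have := (hF t ht (h5 h)).mpr hne
      exact (h3 t this h.ne).2 rfl
    have hs : ∑ σ ∈ F with σ ≤ τ, k σ = (∑ σ ∈ F with σ ≤ t, k σ) + k τ := by
      by_cases hm : τ ∈ F
      · have : (F.filter (fun σ => σ ≤ τ)) = insert τ (F.filter (fun σ => σ ≤ t)) := by
          ext σ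
          simp only [Finset.mem_filter, Finset.mem_insert]
          by_cases hst : σ = τ
          · simp [hst, hm]
          · simp only [hst, false_or]
            exact and_congr_right fun hσ => (h3 σ hσ hst).1.symm
        rw [this, Finset.sum_insert (by simp [h]), add_comm]
      · have hk0 : k τ = 0 := by
          by_contra hne
          exact hm (hFτ.mpr hne)
        rw [hk0, add_zero]
        congr 1
        apply Finset.filter_congr
        intro σ hσ
        have hst : σ ≠ τ := fun h => hm (h ▸ hσ)
        exact (h3 σ hσ hst).1.symm
    simp only [hs]
    omega
  · simp [h]
  · have h4 := hn τ hτ t ht h.le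
    have : (F.filter (fun σ => σ ≤ t)) = F.filter (fun σ => σ ≤ τ) := by
      apply Finset.filter_congr
      intro σ hσ
      by_cases hst : σ = τ
      · simp [hst, h.le]
      · exact (h3 σ hσ hst).1
    simp only [this]
    omega

end Sturm

namespace Sturm
open scoped Topology

/-- Symplectic form. -/
structure Symp {W : Type*} [AddCommGroup W] [Module ℝ W] (ω : W →ₗ[ℝ] W →ₗ[ℝ] ℝ) : Prop where
  alt : ∀ v : W, ω v v = 0
  nd : ∀ v : W, (∀ u : W, ω v u = 0) → v = 0

/-- Lagrangian subspace. -/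
structure Lag {W : Type*} [AddCommGroup W] [Module ℝ W] (ω : W →ₗ[ℝ] W →ₗ[ℝ] ℝ)
    (X : Submodule ℝ W) : Prop where
  iso : ∀ x ∈ X, ∀ y ∈ X, ω x y = 0
  dim : 2 * finrank ℝ X = finrank ℝ W

section Alg
variable {W : Type*} [AddCommGroup W] [Module ℝ W] [FiniteDimensional ℝ W]
  {ω : W →ₗ[ℝ] W →ₗ[ℝ] ℝ}

theorem Symp.skew (hω : Symp ω) (x y : W) : ω x y = - ω y x := by
  have h := hω.alt (x + y)
  simp only [map_add, LinearMap.add_apply, hω.alt] at h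
  linarith

theorem Symp.isRefl (hω : Symp ω) : LinearMap.IsRefl ω := by
  intro x y h
  rw [hω.skew, h, neg_zero]

theorem Symp.nondeg (hω : Symp ω) : LinearMap.BilinForm.Nondegenerate ω := by
  refine ⟨hω.nd, fun y h => hω.nd y fun u => ?_⟩
  rw [hω.skew, h, neg_zero]

theorem Lag.mem (hω : Symp ω) {X : Submodule ℝ W} (hX : Lag ω X) (y : W)
    (h : ∀ x ∈ X, ω y x = 0) : y ∈ X := by
  have hle : X ≤ LinearMap.BilinForm.orthogonal ω X := fun x hx n hn => hX.iso n hn x hx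
  have hfr := LinearMap.BilinForm.finrank_orthogonal hω.nondeg X
  have heq := Submodule.eq_of_le_of_finrank_le hle (by have := hX.dim; omega)
  rw [heq]
  intro n hn
  show ω n y = 0
  rw [hω.skew, h n hn, neg_zero]

theorem Lag.isCompl {X Y : Submodule ℝ W} (hX : Lag ω X) (hY : Lag ω Y) (h : X ⊓ Y = ⊥) :
    IsCompl X Y := by
  refine ⟨disjoint_iff.mpr h, codisjoint_iff.mpr ?_⟩
  apply Submodule.eq_top_of_finrank_eq
  have h1 := Submodule.finrank_sup_add_finrank_inf_eq X Y
  rw [h, finrank_bot] at h1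
  have := hX.dim
  have := hY.dim
  omega

theorem Lag.map {X : Submodule ℝ W} (hX : Lag ω X) (P : W ≃ₗ[ℝ] W)
    (hP : ∀ x y, ω (P x) (P y) = ω x y) : Lag ω (X.map P.toLinearMap) := by
  refine ⟨?_, ?_⟩
  · rintro _ ⟨x, hx, rfl⟩ _ ⟨y, hy, rfl⟩
    exact (hP x y).trans (hX.iso x hx y hy)
  · rw [← hX.dim, LinearEquiv.finrank_map_eq]

open Classical in
/-- Projection onto `X` along `M` (zero if they are not complementary). -/
noncomputable def pr (X M : Submodule ℝ W) : W →ₗ[ℝ] W :=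
  if h : IsCompl X M then X.projection M h else 0

theorem pr_mem {X M : Submodule ℝ W} (h : IsCompl X M) (y : W) : pr X M y ∈ X := by
  simp only [pr, h, dite_true]
  exact Submodule.projection_apply_mem h y

theorem sub_pr_mem {X M : Submodule ℝ W} (h : IsCompl X M) (y : W) : y - pr X M y ∈ M := by
  simp only [pr, h, dite_true]
  exact Submodule.sub_projection_mem h y

theorem pr_add {X M : Submodule ℝ W} (h : IsCompl X M) {x m : W} (hx : x ∈ X) (hm : m ∈ M) :
    pr X M (x + m) = x := by
  simp only [pr, h, dite_true, map_add]
  rw [Submodule.projection_apply_of_mem_left h hx,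
    (Submodule.projection_apply_eq_zero_iff h).mpr hm, add_zero]

/-- The quadratic form `y ↦ ω (y_M) (y_X)`. -/
noncomputable def bf (ω : W →ₗ[ℝ] W →ₗ[ℝ] ℝ) (X M : Submodule ℝ W) : QuadraticForm ℝ W :=
  LinearMap.BilinMap.toQuadraticMap (ω.compl₁₂ (LinearMap.id - pr X M) (pr X M))

theorem bf_apply (X M : Submodule ℝ W) (y : W) :
    bf ω X M y = ω (y - pr X M y) (pr X M y) := by
  simp [bf]

theorem bf_add {X M : Submodule ℝ W} (h : IsCompl X M) {x m : W} (hx : x ∈ X) (hm : m ∈ M) :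
    bf ω X M (x + m) = ω m x := by
  rw [bf_apply, pr_add h hx hm, add_sub_cancel_left]

theorem exists_decomp {X M : Submodule ℝ W} (h : IsCompl X M) (y : W) :
    ∃ x ∈ X, ∃ m ∈ M, y = x + m :=
  ⟨_, pr_mem h y, _, sub_pr_mem h y, by abel⟩

theorem isCompl_map {X M : Submodule ℝ W} (h : IsCompl X M) (P : W ≃ₗ[ℝ] W) :
    IsCompl (X.map P.toLinearMap) (M.map P.toLinearMap) :=
  h.map (Submodule.orderIsoMapComap P)

theorem bf_map {X M : Submodule ℝ W} (h : IsCompl X M) (P : W ≃ₗ[ℝ] W)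
    (hP : ∀ x y, ω (P x) (P y) = ω x y) (y : W) :
    bf ω (X.map P.toLinearMap) (M.map P.toLinearMap) (P y) = bf ω X M y := by
  obtain ⟨x, hx, m, hm, rfl⟩ := exists_decomp h y
  have := bf_add (ω := ω) (isCompl_map h P) (x := P x) (m := P m) ⟨x, hx, rfl⟩ ⟨m, hm, rfl⟩
  rw [bf_add h hx hm, map_add, this, hP]

/-- Index of the form `bf X M` restricted to `Y`. -/
noncomputable def idx (ω : W →ₗ[ℝ] W →ₗ[ℝ] ℝ) (X M Y : Submodule ℝ W) : ℕ :=
  sigNeg ((bf ω X M).comp Y.subtype)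

theorem idx_eq {V : Type*} [AddCommGroup V] [Module ℝ V] [FiniteDimensional ℝ V]
    (X M Y : Submodule ℝ W) (f : V →ₗ[ℝ] W) (hf : Function.Injective f)
    (hY : LinearMap.range f = Y) : sigNeg ((bf ω X M).comp f) = idx ω X M Y := by
  subst hY
  exact sigNeg_eq_of_equiv _ _ (LinearEquiv.ofInjective f hf) (fun x => rfl)

theorem idx_map {X M : Submodule ℝ W} (h : IsCompl X M) (P : W ≃ₗ[ℝ] W)
    (hP : ∀ x y, ω (P x) (P y) = ω x y) (Y : Submodule ℝ W) :
    idx ω (X.map P.toLinearMap) (M.map P.toLinearMap) (Y.map P.toLinearMap) = idx ω X M Y := by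
  symm
  exact sigNeg_eq_of_equiv _ _ (P.submoduleMap Y) (fun x => bf_map h P hP x)

/-- Radical of `bf X M` along a Lagrangian `Y` transversal to `M` is `Y ∩ X`. -/
theorem finrank_radical {V : Type*} [AddCommGroup V] [Module ℝ V] [FiniteDimensional ℝ V]
    (hω : Symp ω) {X M Y : Submodule ℝ W} (hX : Lag ω X) (hM : Lag ω M) (hY : Lag ω Y)
    (hXM : IsCompl X M) (hYM : IsCompl Y M) (f : V →ₗ[ℝ] W) (hf : Function.Injective f)
    (hfY : LinearMap.range f = Y) :
    finrank ℝ ((bf ω X M).comp f).radical = finrank ℝ (Y ⊓ X : Submodule ℝ W) := by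
  have hsymm : ∀ x ∈ X, ∀ m ∈ M, ∀ x' ∈ X, ∀ m' ∈ M, x + m ∈ Y → x' + m' ∈ Y →
      ω m x' = ω m' x := by
    intro x hx m hm x' hx' m' hm' h1 h2
    have h3 := hY.iso _ h1 _ h2
    simp only [map_add, LinearMap.add_apply, hX.iso x hx x' hx', hM.iso m hm m' hm'] at h3
    have := hω.skew x m'
    linarith
  have hrad : ((bf ω X M).comp f).radical = X.comap f := by
    ext v
    rw [QuadraticMap.mem_radical_iff', Submodule.mem_comap]
    have hv : f v ∈ Y := hfY ▸ LinearMap.mem_range_self f v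
    obtain ⟨x, hx, m, hm, hxm⟩ := exists_decomp hXM (f v)
    constructor
    · rintro ⟨h1, h2⟩
      have hmX : m ∈ X := by
        apply hX.mem hω
        intro ξ hξ
        obtain ⟨y, hy, m', hm', hξe⟩ := exists_decomp hYM ξ
        rw [← hfY] at hy
        obtain ⟨u, rfl⟩ := hy
        have h3 := h2 u
        have e : f u = ξ + (- m') := by rw [hξe]; abel
        have hfu : ξ + (-m') ∈ Y := by
          rw [← e, ← hfY]
          exact LinearMap.mem_range_self f u
        have h4 := hsymm x hx m hm _ hξ (-m') (M.neg_mem hm') (hxm ▸ hv) hfu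
        simp only [QuadraticMap.comp_apply, map_add] at h1 h3
        have e2 : f v + f u = (x + ξ) + (m + (-m')) := by rw [hxm, e]; abel
        rw [e2, bf_add hXM (X.add_mem hx hξ) (M.add_mem hm (M.neg_mem hm')), e,
          bf_add hXM hξ (M.neg_mem hm')] at h3
        rw [hxm, bf_add hXM hx hm] at h1
        simp only [map_add, LinearMap.add_apply, h1] at h3 h4 ⊢
        linarith
      rw [hxm]
      exact X.add_mem hx hmX
    · intro hvX
      refine ⟨?_, fun u => ?_⟩
      · rw [QuadraticMap.comp_apply, ← add_zero (f v), bf_add hXM hvX M.zero_mem]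
        simp
      · simp only [QuadraticMap.comp_apply, map_add]
        have hu : f u ∈ Y := hfY ▸ LinearMap.mem_range_self f u
        obtain ⟨x', hx', m', hm', hxm'⟩ := exists_decomp hXM (f u)
        rw [hxm', ← add_assoc, bf_add hXM (X.add_mem hvX hx') hm', bf_add hXM hx' hm', map_add]
        have := hsymm (f v) hvX 0 M.zero_mem x' hx' m' hm' (by simpa using hv) (hxm' ▸ hu)
        rw [← this]
        simp
  rw [hrad, ← hfY, LinearEquiv.finrank_eq (Submodule.equivMapOfInjective f hf _),
    Submodule.map_comap_eq]

/-- Key identity behind the triple index. -/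
theorem triple_identity (hω : Symp ω) {X M Y Z : Submodule ℝ W} (hM : Lag ω M)
    (hX : Lag ω X) (hY : Lag ω Y) (hZ : Lag ω Z)
    (hXM : IsCompl X M) (hYM : IsCompl Y M) (hXY : IsCompl Y X) (u w : W) (hu : u ∈ Z)
    (hw : w ∈ Z) :
    bf ω X M (u + w) - bf ω X Y w = bf ω X M (pr Y X w + pr Y M u) + bf ω Y M u := by
  obtain ⟨wY, hwY, wX, hwX, rfl⟩ := exists_decomp hXY w
  obtain ⟨uY, huY, um, hum, rfl⟩ := exists_decomp hYM u
  rw [pr_add hXY hwY hwX, pr_add hYM huY hum, add_comm wY wX, bf_add hXY.symm hwX hwY,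
    bf_add hYM huY hum]
  obtain ⟨a, ha, m, hm, rfl⟩ := exists_decomp hXM wY
  obtain ⟨b, hb, n, hn, rfl⟩ := exists_decomp hXM uY
  have e1 : b + n + um + (wX + (a + m)) = (b + wX + a) + (n + um + m) := by abel
  have e2 : a + m + (b + n) = (a + b) + (m + n) := by abel
  rw [e1, e2, bf_add hXM (by simp [add_mem, *]) (by simp [add_mem, *]),
    bf_add hXM (by simp [add_mem, *]) (by simp [add_mem, *])]
  have hz := hZ.iso _ hu _ hw
  have hy := hY.iso _ huY _ hwY
  simp only [map_add, LinearMap.add_apply, hX.iso a ha wX hwX, hX.iso b hb a ha,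
    hX.iso b hb wX hwX, hM.iso um hum n hn, hM.iso n hn m hm, hM.iso um hum m hm] at hz hy ⊢
  linarith

theorem idx_triangle (hω : Symp ω) {X M Y Z : Submodule ℝ W} (hM : Lag ω M)
    (hX : Lag ω X) (hY : Lag ω Y) (hZ : Lag ω Z)
    (hXM : IsCompl X M) (hYM : IsCompl Y M) :
    idx ω X M Z ≤ idx ω X M Y + idx ω Y M Z := by
  unfold idx
  rw [← sigNeg_prod]
  let g : Z →ₗ[ℝ] Y × Z :=
    (((pr Y M).codRestrict Y (pr_mem hYM)).comp Z.subtype).prod LinearMap.id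
  refine sigNeg_le_of_inj _ _ g (fun x y h => congrArg Prod.snd h) (fun z => ?_)
  apply le_of_eq
  change bf ω X M (pr Y M (z : W)) + bf ω Y M (z : W) = bf ω X M (z : W)
  obtain ⟨uY, huY, um, hum, hz⟩ := exists_decomp hYM (z : W)
  rw [hz, pr_add hYM huY hum, bf_add hYM huY hum]
  obtain ⟨b, hb, n, hn, rfl⟩ := exists_decomp hXM uY
  rw [add_assoc, bf_add hXM hb hn, bf_add hXM hb (M.add_mem hn hum)]
  simp [hM.iso um hum n hn]

theorem idx_triple (hω : Symp ω) {X M Y Z : Submodule ℝ W} (hM : Lag ω M)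
    (hX : Lag ω X) (hY : Lag ω Y) (hZ : Lag ω Z)
    (hXM : IsCompl X M) (hYM : IsCompl Y M) (hYX : IsCompl Y X) (hZX : IsCompl Z X) :
    idx ω X M Y + idx ω Y M Z = idx ω X M Z + sigNeg (-(bf ω X Y).comp Z.subtype) := by
  unfold idx
  rw [← sigNeg_prod, ← sigNeg_prod]
  -- (u, w) ↦ (u + w, w)  and  (u, w) ↦ (pr w + pr u, u)
  let g1 : (Z × Z) →ₗ[ℝ] (Z × Z) :=
    (LinearMap.fst ℝ Z Z + LinearMap.snd ℝ Z Z).prod (LinearMap.snd ℝ Z Z)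
  let pa : Z →ₗ[ℝ] Y := ((pr Y X).codRestrict Y (pr_mem hYX)).comp Z.subtype
  let pb : Z →ₗ[ℝ] Y := ((pr Y M).codRestrict Y (pr_mem hYM)).comp Z.subtype
  let g2 : (Z × Z) →ₗ[ℝ] (Y × Z) :=
    (pa.comp (LinearMap.snd ℝ Z Z) + pb.comp (LinearMap.fst ℝ Z Z)).prod (LinearMap.fst ℝ Z Z)
  have hpa : Function.Injective pa := by
    rw [← LinearMap.ker_eq_bot, LinearMap.ker_eq_bot']
    intro z hz
    have h0 : pr Y X (z : W) = 0 := congrArg Subtype.val hz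
    have h1 := sub_pr_mem hYX (z : W)
    rw [h0, sub_zero] at h1
    have : (z : W) ∈ Z ⊓ X := ⟨z.2, h1⟩
    rw [hZX.inf_eq_bot] at this
    exact Subtype.ext this
  have hg1 : Function.Injective g1 := by
    rw [← LinearMap.ker_eq_bot, LinearMap.ker_eq_bot']
    rintro ⟨u, w⟩ h
    have h1 : u + w = 0 := congrArg Prod.fst h
    have h2 : w = 0 := congrArg Prod.snd h
    rw [h2, add_zero] at h1
    rw [h1, h2]
    rfl
  have hg2 : Function.Injective g2 := by
    rw [← LinearMap.ker_eq_bot, LinearMap.ker_eq_bot']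
    rintro ⟨u, w⟩ h
    have h1 : pa w + pb u = 0 := congrArg Prod.fst h
    have h2 : u = 0 := congrArg Prod.snd h
    rw [h2, map_zero, add_zero] at h1
    rw [hpa (h1.trans (map_zero pa).symm), h2]
    rfl
  have hd : finrank ℝ Y = finrank ℝ Z := by
    have := hY.dim
    have := hZ.dim
    omega
  let G1 := LinearEquiv.ofInjectiveOfFinrankEq g1 hg1 rfl
  let G2 := LinearEquiv.ofInjectiveOfFinrankEq g2 hg2 (by simp [hd])
  refine sigNeg_eq_of_equiv _ _ (G2.symm.trans G1) (fun x => ?_)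
  obtain ⟨⟨u, w⟩, rfl⟩ := G2.surjective x
  have h1 : G2 (u, w) = g2 (u, w) := rfl
  have h2 : G1 (u, w) = g1 (u, w) := rfl
  rw [LinearEquiv.trans_apply, LinearEquiv.symm_apply_apply, h1, h2]
  have := triple_identity hω hM hX hY hZ hXM hYM hYX u w u.2 w.2
  change bf ω X M ((u : W) + w) + -(bf ω X Y (w : W)) =
    bf ω X M (pr Y X w + pr Y M u) + bf ω Y M u
  rw [← this]
  ring

/-- There is a Lagrangian transversal to finitely many given ones. -/
theorem exists_transversal (hω : Symp ω) {ι : Type} [Finite ι] [Nonempty ι]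
    (X : ι → Submodule ℝ W) (hX : ∀ i, Lag ω (X i)) :
    ∃ M, Lag ω M ∧ ∀ i, X i ⊓ M = ⊥ := by
  have main : ∀ k : ℕ, 2 * k ≤ finrank ℝ W → ∃ I : Submodule ℝ W,
      (∀ x ∈ I, ∀ y ∈ I, ω x y = 0) ∧ finrank ℝ I = k ∧ ∀ i, X i ⊓ I = ⊥ := by
    intro k
    induction k with
    | zero =>
      intro _
      exact ⟨⊥, by simp, by simp, by simp⟩
    | succ k ih =>
      intro hk
      obtain ⟨I, hI, hIk, hIX⟩ := ih (by omega)
      let O := LinearMap.BilinForm.orthogonal ω I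
      have hO : finrank ℝ O = finrank ℝ W - k := by
        rw [← hIk]
        exact LinearMap.BilinForm.finrank_orthogonal hω.nondeg I
      have hnle : ∀ i, ¬ O ≤ I ⊔ X i := by
        intro i hle
        have h1 : LinearMap.BilinForm.orthogonal ω (I ⊔ X i) ≤ I := by
          have := LinearMap.BilinForm.orthogonal_le (B := ω) hle
          rwa [LinearMap.BilinForm.orthogonal_orthogonal hω.nondeg hω.isRefl] at this
        have h2 : O ⊓ X i ≤ I := by
          refine le_trans ?_ h1
          rintro u ⟨hu1, hu2⟩ n hn
          obtain ⟨a, ha, b, hb, rfl⟩ := Submodule.mem_sup.mp hn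
          show ω (a + b) u = 0
          have e1 : ω a u = 0 := hu1 a ha
          have e2 := (hX i).iso b hb u hu2
          simp [e1, e2]
        have h3 : O ⊓ X i = ⊥ := by
          rw [eq_bot_iff, ← hIX i]
          exact le_inf inf_le_right h2
        have h4 := Submodule.finrank_sup_add_finrank_inf_eq O (X i)
        have h5 := Submodule.finrank_le (O ⊔ X i)
        rw [h3, finrank_bot] at h4
        have := (hX i).dim
        omega
      have hv : ∃ v ∈ O, ∀ i, v ∉ I ⊔ X i := by
        by_contra hcon
        push Not at hcon
        have hcov : ⋃ i, (((I ⊔ X i).comap O.subtype : Submodule ℝ O) : Set O) = Set.univ := by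
          ext v
          obtain ⟨i, hi⟩ := hcon v v.2
          simp only [Set.mem_iUnion, Set.mem_univ, iff_true]
          exact ⟨i, hi⟩
        obtain ⟨i, hi⟩ := Subspace.exists_eq_top_of_iUnion_eq_univ hcov
        exact hnle i (Submodule.comap_subtype_eq_top.mp hi)
      obtain ⟨v, hvO, hvn⟩ := hv
      have hvI : ∀ x ∈ I, ω x v = 0 := hvO
      have hdisj : ∀ i, X i ⊓ (I ⊔ Submodule.span ℝ {v}) = ⊥ := by
        intro i
        rw [Submodule.eq_bot_iff]
        rintro z ⟨hz1, hz2⟩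
        obtain ⟨a, ha, b, hb, rfl⟩ := Submodule.mem_sup.mp hz2
        obtain ⟨c, rfl⟩ := Submodule.mem_span_singleton.mp hb
        by_cases hc : c = 0
        · subst hc
          have : a + (0 : ℝ) • v ∈ X i ⊓ I := ⟨hz1, by simpa using ha⟩
          rw [hIX i] at this
          exact this
        · exfalso
          apply hvn i
          have e : v = c⁻¹ • (- a) + c⁻¹ • (a + c • v) := by
            rw [← smul_add, neg_add_cancel_left, smul_smul, inv_mul_cancel₀ hc, one_smul]
          rw [e]
          exact Submodule.add_mem_sup (I.smul_mem _ (I.neg_mem ha)) ((X i).smul_mem _ hz1)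
      refine ⟨I ⊔ Submodule.span ℝ {v}, ?_, ?_, hdisj⟩
      · intro x hx y hy
        obtain ⟨a, ha, b, hb, rfl⟩ := Submodule.mem_sup.mp hx
        obtain ⟨c, rfl⟩ := Submodule.mem_span_singleton.mp hb
        obtain ⟨a', ha', b', hb', rfl⟩ := Submodule.mem_sup.mp hy
        obtain ⟨c', rfl⟩ := Submodule.mem_span_singleton.mp hb'
        have := hω.skew v a'
        simp [hI a ha a' ha', hvI a ha, hvI a' ha', hω.alt, this]
      · have hvI' : v ∉ I := by
          intro h
          obtain ⟨i⟩ := ‹Nonempty ι›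
          exact hvn i (Submodule.mem_sup_left h)
        have h4 := Submodule.finrank_sup_add_finrank_inf_eq I (Submodule.span ℝ {v})
        have hv0 : v ≠ 0 := fun h => hvI' (h ▸ I.zero_mem)
        have h5 : I ⊓ Submodule.span ℝ {v} = ⊥ :=
          disjoint_iff.mp ((Submodule.disjoint_span_singleton' hv0).mpr hvI')
        rw [h5, finrank_bot, finrank_span_singleton hv0] at h4
        omega
  obtain ⟨i0⟩ := ‹Nonempty ι›
  obtain ⟨M, h1, h2, h3⟩ := main (finrank ℝ (X i0)) (hX i0).dim.le
  exact ⟨M, ⟨h1, by rw [h2]; exact (hX i0).dim⟩, h3⟩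

end Alg
end Sturm

namespace Sturm
open scoped Topology
section An
variable {W : Type*} [NormedAddCommGroup W] [NormedSpace ℝ W] [FiniteDimensional ℝ W]
  {V : Type*} [NormedAddCommGroup V] [NormedSpace ℝ V] [FiniteDimensional ℝ V]
  {ω : W →ₗ[ℝ] W →ₗ[ℝ] ℝ}

/-- Pointwise differentiability implies differentiability in operator norm. -/
theorem hasDerivAt_clm (f : ℝ → V →L[ℝ] W) (f' : V →L[ℝ] W) (t : ℝ)
    (h : ∀ v, HasDerivAt (fun s => f s v) (f' v) t) : HasDerivAt f f' t := by
  let b := Module.finBasis ℝ V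
  let c : Fin (finrank ℝ V) → (V →L[ℝ] ℝ) := fun i => LinearMap.toContinuousLinearMap (b.coord i)
  have key : ∀ g : V →L[ℝ] W,
      g = ∑ i, ContinuousLinearMap.smulRightL ℝ V W (c i) (g (b i)) := by
    intro g
    ext v
    have e := congrArg g (b.sum_repr v)
    rw [map_sum] at e
    simp only [map_smul] at e
    rw [← e]
    simp [c]
  have h1 : HasDerivAt (fun s => ∑ i, ContinuousLinearMap.smulRightL ℝ V W (c i) (f s (b i)))
      (∑ i, ContinuousLinearMap.smulRightL ℝ V W (c i) (f' (b i))) t := by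
    apply HasDerivAt.fun_sum
    intro i _
    exact (ContinuousLinearMap.smulRightL ℝ V W (c i)).hasFDerivAt.comp_hasDerivAt t (h (b i))
  rw [← key f'] at h1
  have e : f = fun s => ∑ i, ContinuousLinearMap.smulRightL ℝ V W (c i) (f s (b i)) :=
    funext fun s => key (f s)
  rw [e]
  exact h1

/-- The map `(x, m) ↦ f x + m`. -/
noncomputable def ext (M : Submodule ℝ W) (f : V →L[ℝ] W) : (V × M) →L[ℝ] W :=
  f.comp (ContinuousLinearMap.fst ℝ V M) + M.subtypeL.comp (ContinuousLinearMap.snd ℝ V M)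

theorem ext_apply (M : Submodule ℝ W) (f : V →L[ℝ] W) (x : V) (m : M) :
    ext M f (x, m) = f x + m := rfl

theorem ext_invertible (M : Submodule ℝ W) (f : V →L[ℝ] W) (hf : Function.Injective f)
    (h : IsCompl (LinearMap.range f.toLinearMap) M) : (ext M f).IsInvertible := by
  have hb : Function.Bijective (ext M f).toLinearMap := by
    constructor
    · rw [← LinearMap.ker_eq_bot, LinearMap.ker_eq_bot']
      rintro ⟨x, m⟩ hx
      have hx' : f x + (m : W) = 0 := hx
      have h1 : f x ∈ LinearMap.range f.toLinearMap ⊓ M := by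
        refine ⟨⟨x, rfl⟩, ?_⟩
        rw [eq_neg_of_add_eq_zero_left hx']
        exact M.neg_mem m.2
      rw [h.inf_eq_bot, Submodule.mem_bot] at h1
      rw [h1, zero_add] at hx'
      have h2 : x = 0 := hf (h1.trans (map_zero f).symm)
      have h3 : m = 0 := Subtype.ext hx'
      rw [h2, h3]
      rfl
    · intro w
      obtain ⟨_, ⟨x, rfl⟩, m, hm, rfl⟩ := exists_decomp h w
      exact ⟨(x, ⟨m, hm⟩), rfl⟩
  exact ⟨(LinearEquiv.ofBijective _ hb).toContinuousLinearEquiv, by ext <;> rfl⟩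

theorem inj_of_ext (M : Submodule ℝ W) (f : V →L[ℝ] W) (h : (ext M f).IsInvertible) :
    Function.Injective f := by
  intro x y hxy
  have : ext M f (x, 0) = ext M f (y, 0) := by
    rw [ext_apply, ext_apply, hxy]
  exact congrArg Prod.fst (h.injective this)

theorem compl_of_ext (M : Submodule ℝ W) (f : V →L[ℝ] W) (h : (ext M f).IsInvertible) :
    IsCompl (LinearMap.range f.toLinearMap) M := by
  refine ⟨disjoint_iff.mpr ?_, codisjoint_iff.mpr ?_⟩
  · rw [Submodule.eq_bot_iff]
    rintro _ ⟨⟨x, rfl⟩, hm⟩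
    have : ext M f (x, 0) = ext M f (0, ⟨_, hm⟩) := by
      rw [ext_apply, ext_apply]
      simp
    have h2 : x = 0 := congrArg Prod.fst (h.injective this)
    rw [h2, map_zero]
  · rw [eq_top_iff]
    intro w _
    obtain ⟨⟨x, m⟩, rfl⟩ := h.surjective w
    exact Submodule.add_mem_sup ⟨x, rfl⟩ m.2

theorem pr_ext (M : Submodule ℝ W) (f : V →L[ℝ] W) (h : (ext M f).IsInvertible) (w : W) :
    pr (LinearMap.range f.toLinearMap) M w = f ((ext M f).inverse w).1 := by
  have e : w = f ((ext M f).inverse w).1 + ((ext M f).inverse w).2 :=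
    (h.self_apply_inverse w).symm
  conv_lhs => rw [e]
  exact pr_add (compl_of_ext M f h) ⟨_, rfl⟩ (Subtype.coe_prop _)

theorem ext_eventually {α : Type*} [TopologicalSpace α] (M : Submodule ℝ W) (f : α → V →L[ℝ] W)
    (a : α) (hc : ContinuousAt f a) (h : (ext M (f a)).IsInvertible) :
    ∀ᶠ b in 𝓝 a, (ext M (f b)).IsInvertible := by
  have hc2 : ContinuousAt (fun b => ext M (f b)) a := by
    unfold ext
    exact (hc.clm_comp continuousAt_const).add continuousAt_const
  exact hc2.preimage_mem_nhds (ContinuousLinearEquiv.isOpen.mem_nhds h)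

theorem ext_hasDerivAt (M : Submodule ℝ W) (f : ℝ → V →L[ℝ] W) (f' : V →L[ℝ] W) (t : ℝ)
    (h : HasDerivAt f f' t) :
    HasDerivAt (fun s => ext M (f s)) (f'.comp (ContinuousLinearMap.fst ℝ V M)) t := by
  unfold ext
  have h1 := h.clm_comp (hasDerivAt_const t (ContinuousLinearMap.fst ℝ V M))
  have h2 := HasDerivAt.add h1
    (hasDerivAt_const t (M.subtypeL.comp (ContinuousLinearMap.snd ℝ V M)))
  simp only [ContinuousLinearMap.comp_zero, add_zero] at h2
  exact h2

theorem inverse_hasDerivAt {V' : Type*} [NormedAddCommGroup V'] [NormedSpace ℝ V']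
    [FiniteDimensional ℝ V'] (E : ℝ → V' →L[ℝ] W) (E' : V' →L[ℝ] W) (t : ℝ)
    (h : HasDerivAt E E' t) (hi : (E t).IsInvertible) :
    ∃ I', HasDerivAt (fun s => (E s).inverse) I' t := by
  have : CompleteSpace V' := FiniteDimensional.complete ℝ V'
  have h1 : DifferentiableAt ℝ ContinuousLinearMap.inverse (E t) :=
    (hi.contDiffAt_map_inverse (n := 1)).differentiableAt (by simp)
  exact ⟨_, (h1.comp t h.differentiableAt).hasDerivAt⟩

theorem inverse_continuousOn {α : Type*} [TopologicalSpace α] (U : Set α) (M : Submodule ℝ W)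
    (f : α → V →L[ℝ] W) (hc : ContinuousOn f U) (h : ∀ t ∈ U, (ext M (f t)).IsInvertible) :
    ContinuousOn (fun b => (ext M (f b)).inverse) U := by
  intro t ht
  have h1 : ContinuousAt ContinuousLinearMap.inverse (ext M (f t)) :=
    ((h t ht).contDiffAt_map_inverse (n := 0)).continuousAt
  have hc2 : ContinuousWithinAt (fun b => ext M (f b)) U t := by
    unfold ext
    exact ((hc t ht).clm_comp continuousWithinAt_const).add continuousWithinAt_const
  exact ContinuousAt.comp_continuousWithinAt (g := ContinuousLinearMap.inverse) h1 hc2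

theorem omega_continuousOn {α : Type*} [TopologicalSpace α] {U : Set α} {a b : α → W}
    (ha : ContinuousOn a U) (hb : ContinuousOn b U) :
    ContinuousOn (fun p => ω (a p) (b p)) U := by
  have := (ContinuousOn.clm_apply (f := fun p => ω.toContinuousBilinearMap (a p))
    (ω.toContinuousBilinearMap.continuous.comp_continuousOn ha) hb)
  simpa using this

/-- Joint continuity of the graph forms. -/
theorem bf_continuousOn {V₂ : Type*} [NormedAddCommGroup V₂] [NormedSpace ℝ V₂]
    [FiniteDimensional ℝ V₂] (U : Set ℝ) (M : Submodule ℝ W) (f : ℝ → V →L[ℝ] W)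
    (g : ℝ → V₂ →L[ℝ] W) (hf : ContinuousOn f U) (hg : ContinuousOn g U)
    (h : ∀ t ∈ U, (ext M (f t)).IsInvertible) :
    ContinuousOn (fun p : ℝ × V₂ => (bf ω (LinearMap.range (f p.1).toLinearMap) M).comp
      (g p.1).toLinearMap p.2) (U ×ˢ Set.univ) := by
  have hm : Set.MapsTo (Prod.fst : ℝ × V₂ → ℝ) (U ×ˢ Set.univ) U := fun p hp => hp.1
  have h1 : ContinuousOn (fun p : ℝ × V₂ => g p.1 p.2) (U ×ˢ Set.univ) :=
    (hg.comp continuousOn_fst hm).clm_apply continuousOn_snd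
  have h2 : ContinuousOn (fun p : ℝ × V₂ => f p.1 ((ext M (f p.1)).inverse (g p.1 p.2)).1)
      (U ×ˢ Set.univ) := by
    refine (hf.comp continuousOn_fst hm).clm_apply ?_
    refine continuous_fst.comp_continuousOn ?_
    exact ((inverse_continuousOn U M f hf h).comp continuousOn_fst hm).clm_apply h1
  refine (omega_continuousOn (ω := ω) (h1.sub h2) h2).congr ?_
  rintro ⟨t, v⟩ ⟨ht, -⟩
  simp only [QuadraticMap.comp_apply, ContinuousLinearMap.coe_coe]
  rw [bf_apply, pr_ext M (f t) (h t ht)]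
  rfl

/-- Monotonicity of the graph form of a monotone Lagrangian curve. -/
theorem graph_form_mono (X M : Submodule ℝ W) (hX : Lag ω X) (hM : Lag ω M)
    (hXM : IsCompl X M) (f f' : ℝ → V →L[ℝ] W) (U : Set ℝ) (hU : Convex ℝ U)
    (hd : ∀ t ∈ U, HasDerivAt f (f' t) t) (hi : ∀ t ∈ U, (ext M (f t)).IsInvertible)
    (hL : ∀ t ∈ U, Lag ω (LinearMap.range (f t).toLinearMap))
    (hpos : ∀ t ∈ U, ∀ x, 0 ≤ ω (f' t x) (f t x)) (ξ : W) (hξ : ξ ∈ X) :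
    MonotoneOn (fun t => bf ω X M (f t ((ext M (f t)).inverse ξ).1)) U := by
  have hval : ∀ t ∈ U, bf ω X M (f t ((ext M (f t)).inverse ξ).1)
      = ω (-(((ext M (f t)).inverse ξ).2 : W)) ξ := by
    intro t ht
    have e : f t ((ext M (f t)).inverse ξ).1 + (((ext M (f t)).inverse ξ).2 : W) = ξ :=
      (hi t ht).self_apply_inverse ξ
    have e2 : f t ((ext M (f t)).inverse ξ).1 = ξ + -(((ext M (f t)).inverse ξ).2 : W) := by
      rw [← sub_eq_add_neg]
      exact eq_sub_of_add_eq e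
    rw [e2, bf_add hXM hξ (M.neg_mem (Subtype.coe_prop _))]
  have hder : ∀ t ∈ U, ∃ c, 0 ≤ c ∧
      HasDerivAt (fun t => ω (-(((ext M (f t)).inverse ξ).2 : W)) ξ) c t := by
    intro t ht
    have hE := ext_hasDerivAt M f (f' t) t (hd t ht)
    obtain ⟨I', hI⟩ := inverse_hasDerivAt _ _ t hE (hi t ht)
    have hIξ := hI.clm_apply (hasDerivAt_const t ξ)
    simp only [map_zero, add_zero] at hIξ
    have hEI := hE.clm_apply hIξ
    have hconst : HasDerivAt (fun s => ext M (f s) ((ext M (f s)).inverse ξ)) 0 t := by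
      refine (hasDerivAt_const t ξ).congr_of_eventuallyEq ?_
      filter_upwards [ext_eventually M f t (hd t ht).continuousAt (hi t ht)] with s hs
      exact hs.self_apply_inverse ξ
    have huniq := hEI.unique hconst
    have e : f t ((ext M (f t)).inverse ξ).1 + (((ext M (f t)).inverse ξ).2 : W) = ξ :=
      (hi t ht).self_apply_inverse ξ
    generalize ((ext M (f t)).inverse ξ) = z at *
    have hu2 : f' t z.1 + (f t (I' ξ).1 + ((I' ξ).2 : W)) = 0 := huniq
    let Lc : (V × M) →L[ℝ] ℝ := -((ω.toContinuousBilinearMap.flip ξ).comp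
      (M.subtypeL.comp (ContinuousLinearMap.snd ℝ V M)))
    refine ⟨Lc (I' ξ), ?_, ?_⟩
    · have e3 : Lc (I' ξ) = - ω ((I' ξ).2 : W) ξ := by simp [Lc]
      have e4 : ((I' ξ).2 : W) = -(f' t z.1 + f t (I' ξ).1) := by
        rw [← add_assoc] at hu2
        exact eq_neg_of_add_eq_zero_right hu2
      have e5 : ω ((I' ξ).2 : W) ξ = ω ((I' ξ).2 : W) (f t z.1) := by
        rw [← e, map_add, hM.iso _ (Subtype.coe_prop _) _ (Subtype.coe_prop _), add_zero]
      have e6 : ω (f t (I' ξ).1) (f t z.1) = 0 := (hL t ht).iso _ ⟨_, rfl⟩ _ ⟨_, rfl⟩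
      rw [e3, e5, e4, map_neg, LinearMap.neg_apply, map_add, LinearMap.add_apply, e6, neg_neg,
        add_zero]
      exact hpos t ht _
    · have := Lc.hasFDerivAt.comp_hasDerivAt t hIξ
      refine this.congr_of_eventuallyEq (Filter.Eventually.of_forall fun s => ?_)
      simp [Lc]
  have hmono : MonotoneOn (fun t => ω (-(((ext M (f t)).inverse ξ).2 : W)) ξ) U := by
    apply monotoneOn_of_deriv_nonneg hU
    · intro t ht
      obtain ⟨c, -, hc⟩ := hder t ht
      exact hc.continuousAt.continuousWithinAt
    · intro t ht
      obtain ⟨c, -, hc⟩ := hder t (interior_subset ht)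
      exact hc.differentiableAt.differentiableWithinAt
    · intro t ht
      obtain ⟨c, hc0, hc⟩ := hder t (interior_subset ht)
      rw [hc.deriv]
      exact hc0
  intro s hs t ht hst
  simp only [hval s hs, hval t ht]
  exact hmono hs ht hst

/-- Comparison of indices along a monotone Lagrangian curve. -/
theorem graph_idx (X M : Submodule ℝ W) (hX : Lag ω X) (hM : Lag ω M)
    (hXM : IsCompl X M) (f f' : ℝ → V →L[ℝ] W) (U : Set ℝ) (hU : Convex ℝ U)
    (hd : ∀ t ∈ U, HasDerivAt f (f' t) t) (hi : ∀ t ∈ U, (ext M (f t)).IsInvertible)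
    (hL : ∀ t ∈ U, Lag ω (LinearMap.range (f t).toLinearMap))
    (hpos : ∀ t ∈ U, ∀ x, 0 ≤ ω (f' t x) (f t x)) :
    ∀ s ∈ U, ∀ t ∈ U, s ≤ t →
      sigNeg ((bf ω X M).comp (f t).toLinearMap) ≤ sigNeg ((bf ω X M).comp (f s).toLinearMap) ∧
      sigPos ((bf ω X M).comp (f s).toLinearMap) ≤ sigPos ((bf ω X M).comp (f t).toLinearMap) := by
  -- the change of parametrisation from time `a` to time `b`
  let g : ℝ → ℝ → V →ₗ[ℝ] V := fun a b =>
    (LinearMap.fst ℝ V M) ∘ₗ (ext M (f b)).inverse.toLinearMap ∘ₗ (pr X M) ∘ₗ (f a).toLinearMap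
  have hgx : ∀ a b x, g a b x = ((ext M (f b)).inverse (pr X M (f a x))).1 := fun a b x => rfl
  have hself : ∀ a ∈ U, ∀ x, ((ext M (f a)).inverse (pr X M (f a x))).1 = x := by
    intro a ha x
    have h1 := sub_pr_mem hXM (f a x)
    have h2 : (ext M (f a)).inverse (pr X M (f a x)) = (x, -⟨_, h1⟩) := by
      rw [(hi a ha).inverse_apply_eq, ext_apply]
      simp
    rw [h2]
  have hinj : ∀ a ∈ U, ∀ b ∈ U, Function.Injective (g a b) := by
    intro a ha b hb
    rw [← LinearMap.ker_eq_bot, LinearMap.ker_eq_bot']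
    intro x hx
    rw [hgx] at hx
    -- the vector `pr X M (f a x)` lies in `M` and in `X`
    have h1 := (hi b hb).self_apply_inverse (pr X M (f a x))
    have h2 : f b ((ext M (f b)).inverse (pr X M (f a x))).1 +
      (((ext M (f b)).inverse (pr X M (f a x))).2 : W) = pr X M (f a x) := h1
    rw [hx, map_zero, zero_add] at h2
    have h3 : pr X M (f a x) ∈ X ⊓ M := by
      refine ⟨pr_mem hXM _, ?_⟩
      rw [← h2]
      exact Subtype.coe_prop _
    rw [hXM.inf_eq_bot, Submodule.mem_bot] at h3
    have h4 := hself a ha x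
    rw [h3, map_zero] at h4
    exact h4.symm
  intro s hs t ht hst
  have hm : ∀ ξ ∈ X, _ := fun ξ hξ =>
    graph_form_mono X M hX hM hXM f f' U hU hd hi hL hpos ξ hξ hs ht hst
  constructor
  · refine sigNeg_le_of_inj _ _ (g t s) (hinj t ht s hs) fun x => ?_
    have := hm _ (pr_mem hXM (f t x))
    simp only [hself t ht] at this
    exact this
  · refine sigPos_le_of_inj _ _ (g s t) (hinj s hs t ht) fun x => ?_
    have := hm _ (pr_mem hXM (f s x))
    simp only [hself s hs] at this
    exact this

end An
end Sturm

namespace Sturm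
open scoped Topology

/-- Continuous induction along charts. -/
theorem chart_induction {C : Type*} (T : ℝ) (hT : 0 < T) (Good : ℝ → C → Prop) (Ψ : C → ℝ → ℤ)
    (gen : ℝ → Prop) (hex : ∀ t ∈ Set.Icc 0 T, ∃ M, Good t M)
    (hloc : ∀ t₀ ∈ Set.Icc 0 T, ∀ M, Good t₀ M → ∃ ε > 0, ∀ s ∈ Set.Icc 0 T, ∀ t ∈ Set.Icc 0 T,
      |s - t₀| < ε → |t - t₀| < ε → Good s M ∧ Good t M ∧ (s ≤ t → Ψ M s ≤ Ψ M t))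
    (hind : ∀ s ∈ Set.Icc 0 T, gen s → ∀ M M', Good s M → Good s M' → Ψ M s = Ψ M' s)
    (hgen : {s ∈ Set.Ioc 0 T | ¬ gen s}.Finite)
    (h0 : ∃ M, Good 0 M ∧ 0 ≤ Ψ M 0) : ∃ M, Good T M ∧ 0 ≤ Ψ M T := by
  let E : ℝ → Prop := fun t => ∃ M, Good t M ∧ 0 ≤ Ψ M t
  have hA : ∀ t₀ ∈ Set.Ioc 0 T, (∀ r, 0 ≤ r → r < t₀ → E r) → E t₀ := by
    intro t₀ ht hr
    have htI : t₀ ∈ Set.Icc 0 T := ⟨ht.1.le, ht.2⟩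
    obtain ⟨M, hM⟩ := hex t₀ htI
    obtain ⟨ε, hε, hl⟩ := hloc t₀ htI M hM
    have hinf : (Set.Ioo (max 0 (t₀ - ε)) t₀).Infinite :=
      Set.Ioo_infinite (max_lt ht.1 (by linarith))
    obtain ⟨s, hs, hns⟩ := hinf.exists_notMem_finite hgen
    have hs0 : 0 < s := lt_of_le_of_lt (le_max_left _ _) hs.1
    have hsε : t₀ - ε < s := lt_of_le_of_lt (le_max_right _ _) hs.1
    have hsT : s ≤ T := hs.2.le.trans ht.2
    have hg : gen s := by
      by_contra hg
      exact hns ⟨⟨hs0, hsT⟩, hg⟩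
    obtain ⟨M', hM', hΨ⟩ := hr s hs0.le hs.2
    obtain ⟨h1, h2, h3⟩ := hl s ⟨hs0.le, hsT⟩ t₀ htI
      (by rw [abs_lt]; constructor <;> linarith [hs.2]) (by simpa using hε)
    refine ⟨M, hM, ?_⟩
    have := hind s ⟨hs0.le, hsT⟩ hg M' M hM' h1
    have := h3 hs.2.le
    omega
  have hsub : Set.Icc 0 T ⊆ {t | ∀ r, 0 ≤ r → r ≤ t → E r} := by
    apply IsClosed.Icc_subset_of_forall_exists_gt
    · apply isClosed_of_closure_subset
      intro t₀ ht₀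
      have htI : t₀ ∈ Set.Icc 0 T :=
        closure_minimal Set.inter_subset_right isClosed_Icc ht₀
      have hlt : ∀ r, 0 ≤ r → r < t₀ → E r := by
        intro r hr0 hr
        obtain ⟨x, hx1, hx2⟩ := mem_closure_iff_nhds.mp ht₀ _ (Ioi_mem_nhds hr)
        exact hx2.1 r hr0 (le_of_lt hx1)
      refine ⟨fun r hr0 hr => ?_, htI⟩
      rcases hr.lt_or_eq with h | rfl
      · exact hlt r hr0 h
      · rcases hr0.eq_or_lt with h | h
        · rw [← h]
          exact h0
        · exact hA r ⟨h, htI.2⟩ hlt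
    · intro r hr0 hr
      have : r = 0 := le_antisymm hr hr0
      rw [this]
      exact h0
    · rintro t₀ ⟨ht₀, htI⟩ y hy
      have hy' : t₀ < y := hy
      obtain ⟨M, hM, hΨ⟩ := ht₀ t₀ htI.1 le_rfl
      have htI' : t₀ ∈ Set.Icc 0 T := ⟨htI.1, htI.2.le⟩
      obtain ⟨ε, hε, hl⟩ := hloc t₀ htI' M hM
      let z := min (min y T) (t₀ + ε / 2)
      have hz : t₀ < z := lt_min (lt_min hy htI.2) (by linarith)
      have hz1 : z ≤ y := (min_le_left _ _).trans (min_le_left _ _)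
      have hz2 : z ≤ T := (min_le_left _ _).trans (min_le_right _ _)
      have hz3 : z ≤ t₀ + ε / 2 := min_le_right _ _
      refine ⟨z, fun r hr0 hr => ?_, hz, hz1⟩
      rcases le_or_gt r t₀ with h | h
      · exact ht₀ r hr0 h
      · obtain ⟨h1, h2, h3⟩ := hl t₀ htI' r ⟨hr0, hr.trans hz2⟩ (by simpa using hε)
          (by rw [abs_lt]; constructor <;> linarith)
        exact ⟨M, h2, hΨ.trans (h3 h.le)⟩
  exact hsub ⟨hT.le, le_rfl⟩ T hT.le le_rfl

section Main
variable {W : Type*} [NormedAddCommGroup W] [NormedSpace ℝ W] [FiniteDimensional ℝ W]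
  {V : Type*} [NormedAddCommGroup V] [NormedSpace ℝ V] [FiniteDimensional ℝ V]
  {ω : W →ₗ[ℝ] W →ₗ[ℝ] ℝ}

theorem const_isInvertible (X M : Submodule ℝ W) (hXM : IsCompl X M) :
    (ext M X.subtypeL).IsInvertible := by
  refine ext_invertible M X.subtypeL Subtype.val_injective ?_
  have : LinearMap.range X.subtypeL.toLinearMap = X := Submodule.range_subtype X
  rw [this]
  exact hXM

theorem curve_count (hω : Symp ω) (X M : Submodule ℝ W) (hX : Lag ω X) (hM : Lag ω M)
    (hXM : IsCompl X M) (f f' : ℝ → V →L[ℝ] W) (U : Set ℝ) (hU : Convex ℝ U)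
    (hd : ∀ t ∈ U, HasDerivAt f (f' t) t) (hi : ∀ t ∈ U, (ext M (f t)).IsInvertible)
    (hL : ∀ t ∈ U, Lag ω (LinearMap.range (f t).toLinearMap))
    (hpos : ∀ t ∈ U, ∀ x, 0 ≤ ω (f' t x) (f t x)) (F : Finset ℝ)
    (hF : ∀ t ∈ U, (∃ s ∈ U, s < t) →
      (t ∈ F ↔ LinearMap.range (f t).toLinearMap ⊓ X ≠ ⊥)) :
    ∀ s ∈ U, ∀ t ∈ U,
      idx ω X M (LinearMap.range (f s).toLinearMap) + ∑ σ ∈ F with σ ≤ s,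
        finrank ℝ (LinearMap.range (f σ).toLinearMap ⊓ X : Submodule ℝ W) =
      idx ω X M (LinearMap.range (f t).toLinearMap) + ∑ σ ∈ F with σ ≤ t,
        finrank ℝ (LinearMap.range (f σ).toLinearMap ⊓ X : Submodule ℝ W) := by
  intro s hs t ht
  have hcont : ContinuousOn (fun p : ℝ × V => (bf ω X M).comp
      (f p.1).toLinearMap p.2) (U ×ˢ Set.univ) := by
    have := bf_continuousOn (ω := ω) U M (fun _ => X.subtypeL) f continuousOn_const
      (fun t ht => (hd t ht).continuousAt.continuousWithinAt)
      (fun t ht => const_isInvertible X M hXM)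
    have e : LinearMap.range X.subtypeL.toLinearMap = X := Submodule.range_subtype X
    simp only [e] at this
    exact this
  have hmono := graph_idx X M hX hM hXM f f' U hU hd hi hL hpos
  have key := count_lemma (fun t => sigNeg ((bf ω X M).comp (f t).toLinearMap))
    (fun t => sigPos ((bf ω X M).comp (f t).toLinearMap))
    (fun t => finrank ℝ (LinearMap.range (f t).toLinearMap ⊓ X : Submodule ℝ W)) U
    hU.isPreconnected (finrank ℝ V) ?_ (fun s hs t ht h => (hmono s hs t ht h).1)
    (fun s hs t ht h => (hmono s hs t ht h).2)
    (fun τ hτ => sigNeg_lsc (fun t => (bf ω X M).comp (f t).toLinearMap) U τ hτ hcont)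
    (fun τ hτ => sigPos_lsc (fun t => (bf ω X M).comp (f t).toLinearMap) U τ hτ hcont) F ?_
    s hs t ht
  · simp only [idx_eq X M _ (f s).toLinearMap (inj_of_ext M _ (hi s hs)) rfl,
      idx_eq X M _ (f t).toLinearMap (inj_of_ext M _ (hi t ht)) rfl] at key
    exact key
  · intro t ht
    have e1 := QuadraticForm.sigPos_add_sigNeg_add_radical
      (Q := (bf ω X M).comp (f t).toLinearMap)
    rw [finrank_radical hω hX hM (hL t ht) hXM (compl_of_ext M _ (hi t ht)) (f t).toLinearMap
      (inj_of_ext M _ (hi t ht)) rfl] at e1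
    exact e1
  · intro t ht hex
    rw [hF t ht hex, ne_eq, ne_eq, Submodule.finrank_eq_zero]

/-- A linear equivalence as a continuous linear map. -/
noncomputable def clm (P : W ≃ₗ[ℝ] W) : W →L[ℝ] W := LinearMap.toContinuousLinearMap P.toLinearMap

theorem clm_apply (P : W ≃ₗ[ℝ] W) (x : W) : clm P x = P x := rfl

theorem clm_range (P : W ≃ₗ[ℝ] W) (X : Submodule ℝ W) :
    LinearMap.range ((clm P).comp X.subtypeL).toLinearMap = X.map P.toLinearMap := by
  ext w
  constructor
  · rintro ⟨x, rfl⟩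
    exact ⟨x, x.2, rfl⟩
  · rintro ⟨x, hx, rfl⟩
    exact ⟨⟨x, hx⟩, rfl⟩

theorem clm_inj (P : W ≃ₗ[ℝ] W) (X : Submodule ℝ W) :
    Function.Injective ((clm P).comp X.subtypeL) :=
  fun x y h => Subtype.ext (P.injective h)

theorem clm_inv (P : W ≃ₗ[ℝ] W) : (clm P).inverse = clm P.symm := by
  have : clm P = (P.toContinuousLinearEquiv : W →L[ℝ] W) := rfl
  rw [this, ContinuousLinearMap.inverse_equiv]
  rfl

theorem clm_invertible (P : W ≃ₗ[ℝ] W) : (clm P).IsInvertible := ⟨P.toContinuousLinearEquiv, rfl⟩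

theorem clm_ext (P : W ≃ₗ[ℝ] W) (X M : Submodule ℝ W) (h : IsCompl (X.map P.toLinearMap) M) :
    (ext M ((clm P).comp X.subtypeL)).IsInvertible :=
  ext_invertible M _ (clm_inj P X) (by rw [clm_range]; exact h)

theorem flow_hasDerivAt (P : ℝ → W ≃ₗ[ℝ] W) (A : ℝ → W →ₗ[ℝ] W)
    (hPflow : ∀ v t, HasDerivAt (fun s => P s v) (A t (P t v)) t) (t : ℝ) :
    HasDerivAt (fun s => clm (P s)) ((LinearMap.toContinuousLinearMap (A t)).comp (clm (P t))) t :=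
  hasDerivAt_clm _ _ _ (fun v => hPflow v t)

theorem comp_hasDerivAt (X : Submodule ℝ W) (f : ℝ → W →L[ℝ] W) (f' : W →L[ℝ] W) (t : ℝ)
    (h : HasDerivAt f f' t) :
    HasDerivAt (fun s => (f s).comp X.subtypeL) (f'.comp X.subtypeL) t := by
  have h1 := h.clm_comp (hasDerivAt_const t X.subtypeL)
  simp only [ContinuousLinearMap.comp_zero, add_zero] at h1
  exact h1

theorem flow_count (hω : Symp ω) (P : ℝ → W ≃ₗ[ℝ] W) (A : ℝ → W →ₗ[ℝ] W)
    (hPflow : ∀ v t, HasDerivAt (fun s => P s v) (A t (P t v)) t)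
    (hPsymp : ∀ t x y, ω (P t x) (P t y) = ω x y)
    (Λ M : Submodule ℝ W) (hΛ : Lag ω Λ) (hM : Lag ω M) (hΛM : IsCompl Λ M)
    (U : Set ℝ) (hU : Convex ℝ U) (hi : ∀ t ∈ U, IsCompl (Λ.map (P t).toLinearMap) M)
    (hpos : ∀ t ∈ U, ∀ x ∈ Λ, 0 ≤ ω (A t (P t x)) (P t x)) (F : Finset ℝ)
    (hF : ∀ t ∈ U, (∃ s ∈ U, s < t) → (t ∈ F ↔ Λ.map (P t).toLinearMap ⊓ Λ ≠ ⊥)) :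
    ∀ s ∈ U, ∀ t ∈ U,
      idx ω Λ M (Λ.map (P s).toLinearMap) + ∑ σ ∈ F with σ ≤ s,
        finrank ℝ (Λ.map (P σ).toLinearMap ⊓ Λ : Submodule ℝ W) =
      idx ω Λ M (Λ.map (P t).toLinearMap) + ∑ σ ∈ F with σ ≤ t,
        finrank ℝ (Λ.map (P σ).toLinearMap ⊓ Λ : Submodule ℝ W) := by
  have := curve_count hω Λ M hΛ hM hΛM (fun t => (clm (P t)).comp Λ.subtypeL) _ U hU
    (fun t ht => comp_hasDerivAt Λ _ _ t (flow_hasDerivAt P A hPflow t))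
    (fun t ht => clm_ext (P t) Λ M (hi t ht))
    (fun t ht => by rw [clm_range]; exact hΛ.map (P t) (hPsymp t))
    (fun t ht x => hpos t ht x x.2) F (fun t ht h => by rw [clm_range]; exact hF t ht h)
  have e : ∀ σ, finrank ℝ (LinearMap.range ((clm (P σ)).comp Λ.subtypeL).toLinearMap ⊓ Λ :
      Submodule ℝ W) = finrank ℝ (Λ.map (P σ).toLinearMap ⊓ Λ : Submodule ℝ W) := by
    intro σ
    rw [clm_range]
  simp only [clm_range, e] at this
  exact this

theorem map_map_symm (P : W ≃ₗ[ℝ] W) (M : Submodule ℝ W) :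
    (M.map P.symm.toLinearMap).map P.toLinearMap = M := by
  ext w
  constructor
  · rintro ⟨_, ⟨x, hx, rfl⟩, rfl⟩
    simpa using hx
  · intro hw
    exact ⟨P.symm w, ⟨w, hw, rfl⟩, by simp⟩

theorem map_symm_map (P : W ≃ₗ[ℝ] W) (M : Submodule ℝ W) :
    (M.map P.toLinearMap).map P.symm.toLinearMap = M :=
  map_map_symm P.symm M

theorem gauge (hω : Symp ω) (P Q : ℝ → W ≃ₗ[ℝ] W) (A B : ℝ → W →ₗ[ℝ] W)
    (hPflow : ∀ v t, HasDerivAt (fun s => P s v) (A t (P t v)) t)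
    (hQflow : ∀ v t, HasDerivAt (fun s => Q s v) (B t (Q t v)) t)
    (hPsymp : ∀ t x y, ω (P t x) (P t y) = ω x y)
    (hQsymp : ∀ t x y, ω (Q t x) (Q t y) = ω x y)
    (Λ M : Submodule ℝ W) (hΛ : Lag ω Λ) (hM : Lag ω M)
    (U : Set ℝ) (hU : Convex ℝ U) (hi : ∀ t ∈ U, IsCompl (Λ.map (P t).toLinearMap) M)
    (hi2 : ∀ s ∈ U, ∀ t ∈ U, IsCompl
      ((Λ.map ((Q t).trans (P t).symm).toLinearMap).map (P s).toLinearMap) M)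
    (hcomp : ∀ t ∈ U, ∀ v, 0 ≤ ω (B t v) v - ω (A t v) v) :
    ∀ s ∈ U, ∀ t ∈ U, s ≤ t →
      idx ω (Λ.map (P t).toLinearMap) M (Λ.map (Q t).toLinearMap) ≤
      idx ω (Λ.map (P s).toLinearMap) M (Λ.map (Q s).toLinearMap) := by
  let R : ℝ → W ≃ₗ[ℝ] W := fun t => (Q t).trans (P t).symm
  have hPsymp' : ∀ t x y, ω ((P t).symm x) ((P t).symm y) = ω x y := by
    intro t x y
    rw [← hPsymp t, LinearEquiv.apply_symm_apply, LinearEquiv.apply_symm_apply]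
  have hRsymp : ∀ t x y, ω (R t x) (R t y) = ω x y := by
    intro t x y
    exact (hPsymp' t _ _).trans (hQsymp t x y)
  have hPR : ∀ t, (Λ.map (R t).toLinearMap).map (P t).toLinearMap = Λ.map (Q t).toLinearMap := by
    intro t
    ext w
    constructor
    · rintro ⟨_, ⟨x, hx, rfl⟩, rfl⟩
      exact ⟨x, hx, by simp [R]⟩
    · rintro ⟨x, hx, rfl⟩
      exact ⟨R t x, ⟨x, hx, rfl⟩, by simp [R]⟩
  -- derivative of the gauge-transformed flow
  have hR : ∀ t, ∃ R' : W →L[ℝ] W, HasDerivAt (fun s => clm (R s)) R' t ∧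
      ∀ x, P t (R' x) = B t (Q t x) - A t (Q t x) := by
    intro t
    have hP := flow_hasDerivAt P A hPflow t
    have hQ := flow_hasDerivAt Q B hQflow t
    obtain ⟨I', hI⟩ := inverse_hasDerivAt _ _ t hP (clm_invertible (P t))
    simp only [clm_inv] at hI
    have hRd := hI.clm_comp hQ
    refine ⟨_, hRd, fun x => ?_⟩
    generalize hR'e : (I'.comp (clm (Q t)) + (clm (P t).symm).comp
      ((LinearMap.toContinuousLinearMap (B t)).comp (clm (Q t)))) = R' at *
    have h1 := (hP.clm_comp hRd).clm_apply (hasDerivAt_const t x)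
    have h2 : HasDerivAt (fun s => Q s x) _ t := hQflow x t
    have h3 := h1.unique (h2.congr_of_eventuallyEq (Filter.Eventually.of_forall fun s => by
      simp [clm_apply]))
    simp [clm_apply] at h3
    rw [← h3]
    abel
  choose R' hR' hR'x using hR
  intro s hs t ht hst
  -- moving the reference pair does not change the index
  have hconst : ∀ a ∈ U, ∀ b ∈ U,
      idx ω (Λ.map (P a).toLinearMap) M ((Λ.map (R t).toLinearMap).map (P a).toLinearMap) =
      idx ω (Λ.map (P b).toLinearMap) M ((Λ.map (R t).toLinearMap).map (P b).toLinearMap) := by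
    have hPc : ContinuousOn (fun r => clm (P r)) U := fun r _ =>
      (flow_hasDerivAt P A hPflow r).continuousAt.continuousWithinAt
    have hc := bf_continuousOn (ω := ω) U M (fun r => (clm (P r)).comp Λ.subtypeL)
      (fun r => (clm (P r)).comp (Λ.map (R t).toLinearMap).subtypeL)
      (hPc.clm_comp continuousOn_const) (hPc.clm_comp continuousOn_const)
      (fun r hr => clm_ext (P r) Λ M (hi r hr))
    have hrad : ∀ r ∈ U, finrank ℝ ((bf ω (LinearMap.range
        ((clm (P r)).comp Λ.subtypeL).toLinearMap) M).comp
        ((clm (P r)).comp (Λ.map (R t).toLinearMap).subtypeL).toLinearMap).radical =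
        finrank ℝ (Λ.map (R t).toLinearMap ⊓ Λ : Submodule ℝ W) := by
      intro r hr
      rw [finrank_radical hω (by rw [clm_range]; exact hΛ.map (P r) (hPsymp r)) hM
        ((hΛ.map (R t) (hRsymp t)).map (P r) (hPsymp r)) (by rw [clm_range]; exact hi r hr)
        (hi2 r hr t ht) _ (clm_inj _ _) (clm_range _ _), clm_range,
        ← Submodule.map_inf _ (P r).injective, LinearEquiv.finrank_map_eq]
    intro a ha b hb
    have := sigNeg_const _ U hU.isPreconnected hc _ hrad a ha b hb
    rw [idx_eq _ M _ _ (clm_inj _ _) (clm_range _ _),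
      idx_eq _ M _ _ (clm_inj _ _) (clm_range _ _), clm_range, clm_range] at this
    exact this
  let M' := M.map (P s).symm.toLinearMap
  have hM' : Lag ω M' := hM.map (P s).symm (hPsymp' s)
  have hΛM' : IsCompl Λ M' := by
    have := isCompl_map (hi s hs) (P s).symm
    rw [map_symm_map] at this
    exact this
  have hRM' : ∀ r ∈ U, IsCompl (Λ.map (R r).toLinearMap) M' := by
    intro r hr
    have := isCompl_map (hi2 s hs r hr) (P s).symm
    rw [map_symm_map] at this
    exact this
  have hmono := (graph_idx Λ M' hΛ hM' hΛM' (fun r => (clm (R r)).comp Λ.subtypeL)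
    (fun r => (R' r).comp Λ.subtypeL) U hU
    (fun r hr => comp_hasDerivAt Λ _ _ r (hR' r))
    (fun r hr => clm_ext (R r) Λ M' (hRM' r hr))
    (fun r hr => by rw [clm_range]; exact hΛ.map (R r) (hRsymp r))
    (fun r hr x => by
      change 0 ≤ ω (R' r (x : W)) (R r (x : W))
      have e : P r (R r (x : W)) = Q r (x : W) := by simp [R]
      rw [← hPsymp r, hR'x, e, map_sub, LinearMap.sub_apply]
      exact hcomp r hr _) s hs t ht hst).1
  rw [idx_eq _ M' _ _ (clm_inj _ _) (clm_range _ _),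
    idx_eq _ M' _ _ (clm_inj _ _) (clm_range _ _)] at hmono
  rw [← idx_map hΛM' (P s) (hPsymp s), ← idx_map hΛM' (P s) (hPsymp s), map_map_symm] at hmono
  rw [← hPR t, hconst t ht s hs, ← hPR s]
  exact hmono

end Main
end Sturm

/-- Generalized Sturm comparison theorem: if two families of quadratic Hamiltonians on a
symplectic vector space satisfy `h_t − H_t ≤ 0`, then along the corresponding linear
Hamiltonian flows (with monotone nondecreasing Lagrangian trajectories), the number of
conjugate times in `(0, T]`, counted with the dimension of the intersection, for the
`h`-flow is at most that for the `H`-flow. -/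
theorem generalized_sturm_comparison
    {W : Type*} [NormedAddCommGroup W] [NormedSpace ℝ W] [FiniteDimensional ℝ W]
    (ω : W →ₗ[ℝ] W →ₗ[ℝ] ℝ) (halt : ∀ v : W, ω v v = 0)
    (hnondeg : ∀ v : W, (∀ u : W, ω v u = 0) → v = 0)
    (T : ℝ) (hT : 0 < T)
    -- the (Hessians of the) quadratic Hamiltonians
    (h H : ℝ → W →ₗ[ℝ] W →ₗ[ℝ] ℝ)
    (hsymm : ∀ t x y, h t x y = h t y x) (Hsymm : ∀ t x y, H t x y = H t y x)
    -- the linear Hamiltonian vector fields, defined by ω(h⃗ v, ·) = dh(v)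
    (A B : ℝ → W →ₗ[ℝ] W)
    (hA : ∀ t v u, ω (A t v) u = h t v u) (hB : ∀ t v u, ω (B t v) u = H t v u)
    -- the linear Hamiltonian flows with P₀ = P̃₀ = Id
    (P Q : ℝ → W ≃ₗ[ℝ] W)
    (hP0 : P 0 = LinearEquiv.refl ℝ W) (hQ0 : Q 0 = LinearEquiv.refl ℝ W)
    (hPflow : ∀ v t, HasDerivAt (fun s => P s v) (A t (P t v)) t)
    (hQflow : ∀ v t, HasDerivAt (fun s => Q s v) (B t (Q t v)) t)
    (hPsymp : ∀ t x y, ω (P t x) (P t y) = ω x y)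
    (hQsymp : ∀ t x y, ω (Q t x) (Q t y) = ω x y)
    -- h_t − H_t is nonpositive definite on [0, T]
    (hcomp : ∀ t ∈ Set.Icc (0 : ℝ) T, ∀ v : W, h t v v - H t v v ≤ 0)
    -- Λ₀ is a Lagrangian subspace
    (Λ : Submodule ℝ W)
    (hLagIso : ∀ x ∈ Λ, ∀ y ∈ Λ, ω x y = 0)
    (hLagDim : 2 * finrank ℝ Λ = finrank ℝ W)
    -- the trajectories t ↦ P_t Λ₀ and t ↦ P̃_t Λ₀ are monotone nondecreasing
    (hmonoP : ∀ t ∈ Set.Icc (0 : ℝ) T, ∀ v ∈ Λ.map (P t).toLinearMap, 0 ≤ h t v v)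
    (hmonoQ : ∀ t ∈ Set.Icc (0 : ℝ) T, ∀ v ∈ Λ.map (Q t).toLinearMap, 0 ≤ H t v v)
    -- constant Young diagram: the sets of conjugate times are discrete, hence finite
    (SP SQ : Set ℝ)
    (hSP : SP = {τ ∈ Set.Ioc (0 : ℝ) T | Λ.map (P τ).toLinearMap ⊓ Λ ≠ ⊥})
    (hSQ : SQ = {τ ∈ Set.Ioc (0 : ℝ) T | Λ.map (Q τ).toLinearMap ⊓ Λ ≠ ⊥})
    (hfP : SP.Finite) (hfQ : SQ.Finite) :
    ∑ τ ∈ hfP.toFinset, finrank ℝ (Λ.map (P τ).toLinearMap ⊓ Λ : Submodule ℝ W)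
      ≤ ∑ τ ∈ hfQ.toFinset, finrank ℝ (Λ.map (Q τ).toLinearMap ⊓ Λ : Submodule ℝ W) := by
  have hω : Sturm.Symp ω := ⟨halt, hnondeg⟩
  have hΛ : Sturm.Lag ω Λ := ⟨hLagIso, hLagDim⟩
  have hLP : ∀ t, Sturm.Lag ω (Λ.map (P t).toLinearMap) := fun t => hΛ.map (P t) (hPsymp t)
  have hLQ : ∀ t, Sturm.Lag ω (Λ.map (Q t).toLinearMap) := fun t => hΛ.map (Q t) (hQsymp t)
  have hFP : ∀ t ∈ Set.Ioc (0 : ℝ) T,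
      (t ∈ hfP.toFinset ↔ Λ.map (P t).toLinearMap ⊓ Λ ≠ ⊥) := by
    intro t ht
    rw [Set.Finite.mem_toFinset, hSP]
    exact ⟨fun h => h.2, fun h => ⟨ht, h⟩⟩
  have hFQ : ∀ t ∈ Set.Ioc (0 : ℝ) T,
      (t ∈ hfQ.toFinset ↔ Λ.map (Q t).toLinearMap ⊓ Λ ≠ ⊥) := by
    intro t ht
    rw [Set.Finite.mem_toFinset, hSQ]
    exact ⟨fun h => h.2, fun h => ⟨ht, h⟩⟩
  have hFP2 : ∀ t ∈ hfP.toFinset, t ∈ Set.Ioc (0 : ℝ) T := by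
    intro t ht
    rw [Set.Finite.mem_toFinset, hSP] at ht
    exact ht.1
  have hFQ2 : ∀ t ∈ hfQ.toFinset, t ∈ Set.Ioc (0 : ℝ) T := by
    intro t ht
    rw [Set.Finite.mem_toFinset, hSQ] at ht
    exact ht.1
  -- counting functions
  let NP : ℝ → ℕ := fun t => ∑ τ ∈ hfP.toFinset with τ ≤ t,
    finrank ℝ (Λ.map (P τ).toLinearMap ⊓ Λ : Submodule ℝ W)
  let NQ : ℝ → ℕ := fun t => ∑ τ ∈ hfQ.toFinset with τ ≤ t,
    finrank ℝ (Λ.map (Q τ).toLinearMap ⊓ Λ : Submodule ℝ W)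
  let Good : ℝ → Submodule ℝ W → Prop := fun t M => Sturm.Lag ω M ∧ IsCompl Λ M ∧
    IsCompl (Λ.map (P t).toLinearMap) M ∧ IsCompl (Λ.map (Q t).toLinearMap) M
  let Ψ : Submodule ℝ W → ℝ → ℤ := fun M t => (NQ t : ℤ) - NP t
    + Sturm.idx ω Λ M (Λ.map (Q t).toLinearMap) - Sturm.idx ω Λ M (Λ.map (P t).toLinearMap)
    - Sturm.idx ω (Λ.map (P t).toLinearMap) M (Λ.map (Q t).toLinearMap)
  let gen : ℝ → Prop := fun t => Λ.map (P t).toLinearMap ⊓ Λ = ⊥ ∧ Λ.map (Q t).toLinearMap ⊓ Λ = ⊥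
  have hex : ∀ t ∈ Set.Icc 0 T, ∃ M, Good t M := by
    intro t _
    obtain ⟨M, hM, hMX⟩ := Sturm.exists_transversal hω
      (fun i : Fin 3 => (![Λ, Λ.map (P t).toLinearMap, Λ.map (Q t).toLinearMap] i))
      (fun i => by fin_cases i; exacts [hΛ, hLP t, hLQ t])
    exact ⟨M, hM, hΛ.isCompl hM (hMX 0), (hLP t).isCompl hM (hMX 1), (hLQ t).isCompl hM (hMX 2)⟩
  have hPd := Sturm.flow_hasDerivAt P A hPflow
  have hQd := Sturm.flow_hasDerivAt Q B hQflow
  have hPc : Continuous (fun t => Sturm.clm (P t)) :=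
    continuous_iff_continuousAt.mpr fun t => (hPd t).continuousAt
  have hQc : Continuous (fun t => Sturm.clm (Q t)) :=
    continuous_iff_continuousAt.mpr fun t => (hQd t).continuousAt
  have hPic : Continuous (fun t => Sturm.clm (P t).symm) := by
    refine continuous_iff_continuousAt.mpr fun t => ?_
    obtain ⟨I, hI⟩ := Sturm.inverse_hasDerivAt _ _ t (hPd t) (Sturm.clm_invertible (P t))
    simp only [Sturm.clm_inv] at hI
    exact hI.continuousAt
  have hloc : ∀ t₀ ∈ Set.Icc 0 T, ∀ M, Good t₀ M → ∃ ε > 0, ∀ s ∈ Set.Icc 0 T,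
      ∀ t ∈ Set.Icc 0 T, |s - t₀| < ε → |t - t₀| < ε →
      Good s M ∧ Good t M ∧ (s ≤ t → Ψ M s ≤ Ψ M t) := by
    rintro t₀ ht₀ M ⟨hM, hΛM, hPM, hQM⟩
    have ev1 := Sturm.ext_eventually M (fun t => (Sturm.clm (P t)).comp Λ.subtypeL) t₀
      (hPc.clm_comp continuous_const).continuousAt (Sturm.clm_ext _ _ _ hPM)
    have ev2 := Sturm.ext_eventually M (fun t => (Sturm.clm (Q t)).comp Λ.subtypeL) t₀
      (hQc.clm_comp continuous_const).continuousAt (Sturm.clm_ext _ _ _ hQM)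
    have hcont3 : Continuous (fun p : ℝ × ℝ => ((Sturm.clm (P p.1)).comp
        ((Sturm.clm (P p.2).symm).comp (Sturm.clm (Q p.2)))).comp Λ.subtypeL) :=
      ((hPc.comp continuous_fst).clm_comp ((hPic.comp continuous_snd).clm_comp
        (hQc.comp continuous_snd))).clm_comp continuous_const
    have hrange : ∀ s t, LinearMap.range (((Sturm.clm (P s)).comp
        ((Sturm.clm (P t).symm).comp (Sturm.clm (Q t)))).comp Λ.subtypeL).toLinearMap =
        (Λ.map ((Q t).trans (P t).symm).toLinearMap).map (P s).toLinearMap := by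
      intro s t
      ext w
      constructor
      · rintro ⟨x, rfl⟩
        exact ⟨_, ⟨x, x.2, rfl⟩, rfl⟩
      · rintro ⟨_, ⟨x, hx, rfl⟩, rfl⟩
        exact ⟨⟨x, hx⟩, rfl⟩
    have ev3 := Sturm.ext_eventually M (fun p : ℝ × ℝ => ((Sturm.clm (P p.1)).comp
        ((Sturm.clm (P p.2).symm).comp (Sturm.clm (Q p.2)))).comp Λ.subtypeL) (t₀, t₀)
      hcont3.continuousAt (by
        have e : ((Sturm.clm (P t₀)).comp ((Sturm.clm (P t₀).symm).comp
            (Sturm.clm (Q t₀)))).comp Λ.subtypeL = (Sturm.clm (Q t₀)).comp Λ.subtypeL := by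
          ext x
          simp [Sturm.clm_apply]
        change (Sturm.ext M (((Sturm.clm (P t₀)).comp ((Sturm.clm (P t₀).symm).comp
            (Sturm.clm (Q t₀)))).comp Λ.subtypeL)).IsInvertible
        rw [e]
        exact Sturm.clm_ext _ _ _ hQM)
    obtain ⟨ε₁, hε₁, h1⟩ := Metric.eventually_nhds_iff.mp ev1
    obtain ⟨ε₂, hε₂, h2⟩ := Metric.eventually_nhds_iff.mp ev2
    obtain ⟨ε₃, hε₃, h3⟩ := Metric.eventually_nhds_iff.mp ev3
    let ε := min ε₁ (min ε₂ ε₃)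
    let U : Set ℝ := Metric.ball t₀ ε ∩ Set.Icc 0 T
    have hU : Convex ℝ U := (convex_ball t₀ ε).inter (convex_Icc 0 T)
    have hU1 : ∀ t ∈ U, IsCompl (Λ.map (P t).toLinearMap) M := by
      intro t ht
      have := Sturm.compl_of_ext M _ (h1 (lt_of_lt_of_le ht.1 (min_le_left _ _)))
      rwa [Sturm.clm_range] at this
    have hU2 : ∀ t ∈ U, IsCompl (Λ.map (Q t).toLinearMap) M := by
      intro t ht
      have := Sturm.compl_of_ext M _ (h2 (lt_of_lt_of_le ht.1
        ((min_le_right _ _).trans (min_le_left _ _))))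
      rwa [Sturm.clm_range] at this
    have hU3 : ∀ s ∈ U, ∀ t ∈ U, IsCompl
        ((Λ.map ((Q t).trans (P t).symm).toLinearMap).map (P s).toLinearMap) M := by
      intro s hs t ht
      have hd : dist ((s, t) : ℝ × ℝ) (t₀, t₀) < ε₃ := by
        rw [Prod.dist_eq]
        refine max_lt (lt_of_lt_of_le hs.1 ?_) (lt_of_lt_of_le ht.1 ?_) <;>
        exact (min_le_right _ _).trans (min_le_right _ _)
      have := Sturm.compl_of_ext M _ (h3 hd)
      rwa [hrange] at this
    have hUpos : ∀ t ∈ U, (∃ s ∈ U, s < t) → t ∈ Set.Ioc (0 : ℝ) T := by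
      rintro t ht ⟨s, hs, hst⟩
      exact ⟨lt_of_le_of_lt hs.2.1 hst, ht.2.2⟩
    have c1 := Sturm.flow_count hω P A hPflow hPsymp Λ M hΛ hM hΛM U hU hU1
      (fun t ht x hx => by
        rw [hA]
        exact hmonoP t ht.2 _ ⟨x, hx, rfl⟩) hfP.toFinset
      (fun t ht h => hFP t (hUpos t ht h))
    have c2 := Sturm.flow_count hω Q B hQflow hQsymp Λ M hΛ hM hΛM U hU hU2
      (fun t ht x hx => by
        rw [hB]
        exact hmonoQ t ht.2 _ ⟨x, hx, rfl⟩) hfQ.toFinset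
      (fun t ht h => hFQ t (hUpos t ht h))
    have c3 := Sturm.gauge hω P Q A B hPflow hQflow hPsymp hQsymp Λ M hΛ hM U hU hU1 hU3
      (fun t ht v => by
        rw [hA, hB]
        have := hcomp t ht.2 v
        linarith)
    refine ⟨ε, lt_min hε₁ (lt_min hε₂ hε₃), fun s hs t ht hsε htε => ?_⟩
    have hsU : s ∈ U := ⟨hsε, hs⟩
    have htU : t ∈ U := ⟨htε, ht⟩
    refine ⟨⟨hM, hΛM, hU1 s hsU, hU2 s hsU⟩, ⟨hM, hΛM, hU1 t htU, hU2 t htU⟩, fun hst => ?_⟩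
    have d1 := c1 s hsU t htU
    have d2 := c2 s hsU t htU
    have d3 := c3 s hsU t htU hst
    change _ + NP s = _ + NP t at d1
    change _ + NQ s = _ + NQ t at d2
    simp only [Ψ]
    omega
  have hind : ∀ s ∈ Set.Icc 0 T, gen s → ∀ M M', Good s M → Good s M' → Ψ M s = Ψ M' s := by
    rintro s _ ⟨hgP, hgQ⟩ M M' ⟨hM, hΛM, hPM, hQM⟩ ⟨hM', hΛM', hPM', hQM'⟩
    have cP := (hLP s).isCompl hΛ hgP
    have cQ := (hLQ s).isCompl hΛ hgQ
    have e1 := Sturm.idx_triple hω hM hΛ (hLP s) (hLQ s) hΛM hPM cP cQ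
    have e2 := Sturm.idx_triple hω hM' hΛ (hLP s) (hLQ s) hΛM' hPM' cP cQ
    simp only [Ψ]
    omega
  have hgen : {s ∈ Set.Ioc 0 T | ¬ gen s}.Finite := by
    refine (hfP.union hfQ).subset ?_
    rintro s ⟨hs, hng⟩
    by_cases h : Λ.map (P s).toLinearMap ⊓ Λ = ⊥
    · right
      rw [hSQ]
      exact ⟨hs, fun h' => hng ⟨h, h'⟩⟩
    · left
      rw [hSP]
      exact ⟨hs, h⟩
  have h0 : ∃ M, Good 0 M ∧ 0 ≤ Ψ M 0 := by
    obtain ⟨M, hM⟩ := hex 0 ⟨le_rfl, hT.le⟩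
    refine ⟨M, hM, ?_⟩
    have eP : Λ.map (P 0).toLinearMap = Λ := by
      rw [hP0]
      exact Submodule.map_id Λ
    have eQ : Λ.map (Q 0).toLinearMap = Λ := by
      rw [hQ0]
      exact Submodule.map_id Λ
    have hidx : Sturm.idx ω Λ M Λ = 0 := by
      have e1 := QuadraticForm.sigPos_add_sigNeg_add_radical
        (Q := (Sturm.bf ω Λ M).comp Λ.subtype)
      rw [Sturm.finrank_radical hω hΛ hM.1 hΛ hM.2.1 hM.2.1 Λ.subtype Subtype.val_injective
        (Submodule.range_subtype Λ), inf_idem] at e1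
      unfold Sturm.idx
      omega
    have nP : NP 0 = 0 := by
      apply Finset.sum_eq_zero
      intro τ hτ
      rw [Finset.mem_filter] at hτ
      have := (hFP2 τ hτ.1).1
      linarith [hτ.2]
    simp only [Ψ, eP, eQ, hidx, nP]
    omega
  obtain ⟨M, ⟨hM, hΛM, hPM, hQM⟩, hΨ⟩ :=
    Sturm.chart_induction T hT Good Ψ gen hex hloc hind hgen h0
  have htri := Sturm.idx_triangle hω hM hΛ (hLP T) (hLQ T) hΛM hPM
  have nP : NP T = ∑ τ ∈ hfP.toFinset, finrank ℝ (Λ.map (P τ).toLinearMap ⊓ Λ : Submodule ℝ W) := by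
    simp only [NP]
    rw [Finset.filter_true_of_mem fun τ hτ => (hFP2 τ hτ).2]
  have nQ : NQ T = ∑ τ ∈ hfQ.toFinset, finrank ℝ (Λ.map (Q τ).toLinearMap ⊓ Λ : Submodule ℝ W) := by
    simp only [NQ]
    rw [Finset.filter_true_of_mem fun τ hτ => (hFQ2 τ hτ).2]
  rw [← nP, ← nQ]
  simp only [Ψ] at hΨ
  omega
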